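/- Let n be an odd prime and let 𝔽_q be a finite field of characteristic 2 with gcd(q, n) = 1. For a monic n-th-power-free polynomial f ∈ 𝔽_q[x] and 1 ≤ i ≤ n-1, let e_i(f) be the sum of deg Q over the distinct monic irreducible polynomials Q dividing f to multiplicity exactly i; let m(f) = ∑_{i=1}^{n-1} e_i(f) if n divides deg f, and m(f) = ∑_{i=1}^{n-1} e_i(f) + 1 otherwise. Say f is 'ordinary' if either (a) n divides deg f and e_i(f) = e_{n-i}(f) for all 1 ≤ i ≤ n-1, or (b) n does not divide deg f and, letting i₀ ∈ {1,…,n-1} be the unique index with deg f + i₀ ≡ 0 (mod n), we have e_{i₀}(f) + 1 = e_{n-i₀}(f) and e_j(f) = e_{n-j}(f) for all j ∉ {i₀, n-i₀}. Then, as the real number X → ∞, the ratio #{f monic n-th-power-free : q^{m(f)} ≤ X and f ordinary} / #{f monic n-th-power-free : q^{m(f)} ≤ X} tends to 0. -/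

import Mathlib

open Polynomial Filter Topology

namespace OrdProof
open scoped Classical

lemma centralBinom_sq (k : ℕ) : (Nat.centralBinom k)^2 * (2*k+1) ≤ 16^k := by
  induction k with
  | zero => simp
  | succ k ih =>
    have h := Nat.succ_mul_centralBinom_succ k
    have h2 : (k+1)^2 * ((Nat.centralBinom (k+1))^2 * (2*(k+1)+1)) ≤ (k+1)^2 * 16^(k+1) := by
      calc (k+1)^2 * ((Nat.centralBinom (k+1))^2 * (2*(k+1)+1))
          = ((k+1) * Nat.centralBinom (k+1))^2 * (2*(k+1)+1) := by ring
        _ = (Nat.centralBinom k ^2 * (2*k+1)) * (4 * ((2*k+1)*(2*k+3))) := by rw [h]; ring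
        _ ≤ 16^k * (4 * (4*(k+1)^2)) := Nat.mul_le_mul ih (by nlinarith)
        _ = (k+1)^2 * 16^(k+1) := by ring
    exact Nat.le_of_mul_le_mul_left h2 (by positivity)

lemma choose_half_sq (w : ℕ) : (w.choose (w/2))^2 * (w+1) ≤ 4^w := by
  rcases Nat.even_or_odd' w with ⟨k, rfl | rfl⟩
  · have := centralBinom_sq k
    rw [Nat.centralBinom_eq_two_mul_choose] at this
    rw [Nat.mul_div_cancel_left _ (by norm_num), pow_mul]
    simpa using this
  · have := centralBinom_sq (k+1)
    rw [Nat.centralBinom_eq_two_mul_choose] at this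
    have e1 : (2*k+1)/2 = k := by omega
    have e2 : (2*(k+1)).choose (k+1) = 2 * (2*k+1).choose k := by
      rw [show 2*(k+1) = (2*k+1)+1 by ring, Nat.choose_succ_succ, Nat.choose_symm_half]; ring
    rw [e2] at this
    rw [e1]
    have e3 : (4:ℕ)^(2*k+1) * 4 = 16^(k+1) := by
      rw [← pow_succ, show 2*k+1+1 = 2*(k+1) by ring, pow_mul]; norm_num
    nlinarith

def sg (n i : ℕ) : ℤ := if 2 * i < n then 1 else -1

lemma sg_sub (n i : ℕ) (hodd : Odd n) (h : i ≤ n) : sg n (n - i) = - sg n i := by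
  obtain ⟨k, rfl⟩ := hodd
  unfold sg
  split_ifs <;> first | rfl | omega

variable {ι : Type*} [Fintype ι]

def Phi (n : ℕ) (d : ι → ℕ) (c : ι → (ZMod n)ˣ) : ℤ :=
  ∑ P, sg n (c P : ZMod n).val * d P

lemma sg_neg (n : ℕ) [hn : Fact n.Prime] (hodd : Odd n) (u : (ZMod n)ˣ) :
    sg n ((-u : (ZMod n)ˣ) : ZMod n).val = - sg n (u : ZMod n).val := by
  have : NeZero (u : ZMod n) := ⟨u.ne_zero⟩
  rw [Units.val_neg, ZMod.val_neg_of_ne_zero, sg_sub n _ hodd (ZMod.val_lt _).le]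

noncomputable def flip {n : ℕ} (t : Finset ι) (c : ι → (ZMod n)ˣ) : ι → (ZMod n)ˣ :=
  fun P => if P ∈ t then - c P else c P

lemma flip_flip {n : ℕ} (t : Finset ι) (c : ι → (ZMod n)ˣ) : flip t (flip t c) = c := by
  funext P; unfold flip; split_ifs <;> simp

lemma LO_fixed (n : ℕ) [hn : Fact n.Prime] (hodd : Odd n) (d : ι → ℕ) (hd : ∀ P, 0 < d P)
    (v : ℤ) (c : ι → (ZMod n)ˣ) :
    (Finset.univ.filter (fun t : Finset ι => Phi n d (flip t c) = v)).card
      ≤ (Fintype.card ι).choose (Fintype.card ι / 2) := by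
  set N : Finset ι := Finset.univ.filter (fun P => sg n (c P : ZMod n).val = -1) with hN
  have key : ∀ t : Finset ι, Phi n d (flip t c) =
      ∑ P, (if P ∈ symmDiff t N then -1 else 1 : ℤ) * d P := by
    intro t
    unfold Phi
    refine Finset.sum_congr rfl fun P _ => ?_
    congr 1
    have h1 : sg n (c P : ZMod n).val = 1 ∨ sg n (c P : ZMod n).val = -1 := by
      unfold sg; split_ifs <;> simp
    have h2 := sg_neg n hodd (c P)
    unfold flip
    rcases h1 with h | h <;> by_cases ht : P ∈ t <;>
      simp [Finset.mem_symmDiff, hN, h, ht, -Units.val_neg, h2]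
  have inj : Function.Injective (fun t : Finset ι => symmDiff t N) := symmDiff_left_injective N
  rw [← Finset.card_image_of_injective _ inj]
  apply IsAntichain.sperner
  intro a ha b hb hab hsub
  simp only [Finset.coe_image, Finset.coe_filter, Finset.mem_univ, true_and, Set.mem_image,
    Set.mem_ofPred_eq] at ha hb
  obtain ⟨t, ht, rfl⟩ := ha
  obtain ⟨t', ht', rfl⟩ := hb
  rw [key] at ht ht'
  obtain ⟨P0, hP0, hP0'⟩ := Finset.exists_of_ssubset (Finset.ssubset_iff_subset_ne.2 ⟨hsub, hab⟩)
  have : ∑ P, (if P ∈ symmDiff t' N then -1 else 1 : ℤ) * d P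
      < ∑ P, (if P ∈ symmDiff t N then -1 else 1 : ℤ) * d P := by
    apply Finset.sum_lt_sum
    · intro P _
      by_cases h : P ∈ symmDiff t N
      · have h' := hsub h
        rw [if_pos h, if_pos h']
      · rw [if_neg h]
        split_ifs <;> simp
    · refine ⟨P0, Finset.mem_univ _, ?_⟩
      rw [if_pos hP0, if_neg hP0']
      have := hd P0; push_cast; omega
  omega

lemma LO (n : ℕ) [hn : Fact n.Prime] (hodd : Odd n) (d : ι → ℕ) (hd : ∀ P, 0 < d P) (v : ℤ) :
    2 ^ Fintype.card ι * (Finset.univ.filter (fun c : ι → (ZMod n)ˣ => Phi n d c = v)).card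
      ≤ (Fintype.card ι).choose (Fintype.card ι / 2) * (n-1)^Fintype.card ι := by
  have h1 : ∀ t : Finset ι, (Finset.univ.filter (fun c : ι → (ZMod n)ˣ => Phi n d c = v)).card
      = (Finset.univ.filter (fun c : ι → (ZMod n)ˣ => Phi n d (flip t c) = v)).card := by
    intro t
    refine Finset.card_bij' (fun c _ => flip t c) (fun c _ => flip t c) ?_ ?_ ?_ ?_
    · intro c hc; simpa [flip_flip] using hc
    · intro c hc; simpa [flip_flip] using hc
    · intro c _; exact flip_flip t c
    · intro c _; exact flip_flip t c
  calc 2 ^ Fintype.card ι * (Finset.univ.filter (fun c : ι → (ZMod n)ˣ => Phi n d c = v)).card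
      = ∑ t : Finset ι, (Finset.univ.filter (fun c : ι → (ZMod n)ˣ => Phi n d c = v)).card := by
        simp
    _ = ∑ t : Finset ι, (Finset.univ.filter
          (fun c : ι → (ZMod n)ˣ => Phi n d (flip t c) = v)).card :=
        Finset.sum_congr rfl fun t _ => h1 t
    _ = ∑ c : ι → (ZMod n)ˣ, (Finset.univ.filter
          (fun t : Finset ι => Phi n d (flip t c) = v)).card := by
        simp only [Finset.card_filter]; exact Finset.sum_comm
    _ ≤ ∑ c : ι → (ZMod n)ˣ, (Fintype.card ι).choose (Fintype.card ι / 2) :=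
        Finset.sum_le_sum fun c _ => LO_fixed n hodd d hd v c
    _ = _ := by
        simp [Nat.totient_prime hn.out, mul_comm]

lemma spread (n : ℕ) [hn : Fact n.Prime] (hodd : Odd n) (d : ι → ℕ)
    (c0 : ι → (ZMod n)ˣ) (h0 : ∑ P, (c0 P : ZMod n) * d P = 0) :
    (n-1)^Fintype.card ι ≤ (n-1)^2 *
      (Finset.univ.filter (fun c : ι → (ZMod n)ˣ => ∑ P, (c P : ZMod n) * d P = 0)).card := by
  have hn1 : 1 ≤ n - 1 := by have := hn.out.two_le; omega
  have hcard : (n-1)^Fintype.card ι = Fintype.card (ι → (ZMod n)ˣ) := by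
    simp [Nat.totient_prime hn.out]
  by_cases hall : ∀ P, (d P : ZMod n) = 0
  · rw [Finset.filter_true_of_mem (by intro c _; simp [hall]), Finset.card_univ, ← hcard]
    exact Nat.le_mul_of_pos_left _ (by positivity)
  push Not at hall
  obtain ⟨P1, hP1⟩ := hall
  have h2 : ∃ P2, P2 ≠ P1 ∧ (d P2 : ZMod n) ≠ 0 := by
    by_contra hcon
    push Not at hcon
    rw [Finset.sum_eq_single P1 (by intro b _ hb; simp [hcon b hb]) (by simp)] at h0
    exact (mul_ne_zero (c0 P1).ne_zero hP1) h0
  obtain ⟨P2, h21, hP2⟩ := h2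
  have two : (2 : ZMod n) ≠ 0 := by
    intro h
    have : (n : ℕ) ∣ 2 := by
      have := (ZMod.natCast_eq_zero_iff 2 n).1 (by exact_mod_cast h)
      exact this
    have := Nat.le_of_dvd (by norm_num) this
    have := hn.out.two_le
    obtain ⟨k, hk⟩ := hodd
    omega
  have ex : ∀ c : ι → (ZMod n)ˣ, ∃ c' : ι → (ZMod n)ˣ,
      (∀ P, P ≠ P1 → P ≠ P2 → c' P = c P) ∧ ∑ P, (c' P : ZMod n) * d P = 0 := by
    intro c
    set R : ZMod n := ∑ P ∈ (Finset.univ.erase P1).erase P2, (c P : ZMod n) * d P with hR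
    have hsplit : ∀ c' : ι → (ZMod n)ˣ, (∀ P, P ≠ P1 → P ≠ P2 → c' P = c P) →
        ∑ P, (c' P : ZMod n) * d P = (c' P1 : ZMod n) * d P1 + ((c' P2 : ZMod n) * d P2 + R) := by
      intro c' hc'
      rw [← Finset.add_sum_erase _ _ (Finset.mem_univ P1), ← Finset.add_sum_erase
        (Finset.univ.erase P1) _ (Finset.mem_erase.2 ⟨h21, Finset.mem_univ P2⟩), hR]
      congr 2
      refine Finset.sum_congr rfl fun P hP => ?_
      simp only [Finset.mem_erase] at hP
      rw [hc' P hP.2.1 hP.1]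
    have hu : ∃ u : (ZMod n)ˣ, (u : ZMod n) * d P2 + R ≠ 0 := by
      by_contra hcon
      push Not at hcon
      have a1 := hcon 1
      have a2 := hcon (Units.mk0 2 two)
      simp only [Units.val_one, Units.val_mk0] at a1 a2
      apply hP2
      linear_combination a2 - a1
    obtain ⟨u, hu⟩ := hu
    have hb : -((u : ZMod n) * d P2 + R) / d P1 ≠ 0 := div_ne_zero (neg_ne_zero.2 hu) hP1
    refine ⟨Function.update (Function.update c P2 u) P1 (Units.mk0 _ hb), ?_, ?_⟩
    · intro P h1 h2
      simp [Function.update_of_ne, h1, h2]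
    · rw [hsplit _ (by intro P h1 h2; simp [Function.update_of_ne, h1, h2])]
      rw [Function.update_self, Function.update_of_ne h21, Function.update_self, Units.val_mk0]
      field_simp
      ring
  choose g hg1 hg2 using ex
  rw [hcard]
  have hinj : Function.Injective (fun c : ι → (ZMod n)ˣ =>
      ((c P1, c P2), (⟨g c, hg2 c⟩ : {c : ι → (ZMod n)ˣ // ∑ P, (c P : ZMod n) * d P = 0}))) := by
    intro a b hab
    simp only [Prod.mk.injEq, Subtype.mk.injEq] at hab
    funext P
    by_cases h1 : P = P1
    · rw [h1]; exact hab.1.1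
    by_cases h2 : P = P2
    · rw [h2]; exact hab.1.2
    rw [← hg1 a P h1 h2, ← hg1 b P h1 h2, hab.2]
  have := Fintype.card_le_of_injective _ hinj
  simpa [Nat.totient_prime hn.out, Fintype.card_subtype, pow_two] using this

section Polys

variable {F : Type*} [Field F] [Fintype F]

lemma finite_degLT (F : Type*) [Field F] [Fintype F] (N : ℕ) :
    {p : F[X] | p.degree < N}.Finite := by
  have h : Finite (degreeLT F N) := Finite.of_equiv _ (degreeLTEquiv F N).symm.toEquiv
  have h2 : ((degreeLT F N : Submodule F F[X]) : Set F[X]).Finite := Set.toFinite _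
  refine h2.subset ?_
  intro p hp
  exact mem_degreeLT.2 hp

/-- polynomials of degree less than `N` -/
noncomputable def G (F : Type*) [Field F] [Fintype F] (N : ℕ) : Finset F[X] :=
  (finite_degLT F N).toFinset

lemma mem_G {N : ℕ} {p : F[X]} : p ∈ G F N ↔ p.degree < N := by simp [G]

lemma card_G (N : ℕ) : (G F N).card = Fintype.card F ^ N := by
  have h : (G F N).card = Nat.card (degreeLT F N) := by
    rw [← Nat.card_eq_finsetCard]
    apply Nat.card_congr
    exact Equiv.subtypeEquivRight (fun p => by rw [mem_G, mem_degreeLT])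
  rw [h, Nat.card_congr (degreeLTEquiv F N).toEquiv]
  simp

lemma card_mult {N : ℕ} {D : F[X]} (hD : D.Monic) (h : D.natDegree ≤ N) :
    ((G F N).filter (fun g => D ∣ g)).card = Fintype.card F ^ (N - D.natDegree) := by
  rw [← card_G (F := F) (N - D.natDegree)]
  rw [← Finset.card_image_of_injective (G F (N - D.natDegree)) (mul_right_injective₀ hD.ne_zero)]
  congr 1
  have aux : ∀ k : F[X], (D * k).degree < N ↔ k.degree < ((N - D.natDegree : ℕ) : WithBot ℕ) := by
    intro k
    by_cases hk : k = 0
    · simp [hk]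
    · rw [degree_eq_natDegree (mul_ne_zero hD.ne_zero hk), degree_eq_natDegree hk,
        natDegree_mul hD.ne_zero hk, Nat.cast_lt, Nat.cast_lt]
      omega
  ext g
  simp only [Finset.mem_filter, mem_G, Finset.mem_image]
  constructor
  · rintro ⟨hg, k, rfl⟩
    exact ⟨k, (aux k).1 hg, rfl⟩
  · rintro ⟨k, hk, rfl⟩
    exact ⟨(aux k).2 hk, Dvd.intro _ rfl⟩

/-- monic irreducible -/
def MI (P : F[X]) : Prop := P.Monic ∧ Irreducible P

lemma MI.not_dvd {P Q : F[X]} (hP : MI P) (hQ : MI Q) (h : P ≠ Q) : ¬ P ∣ Q := by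
  intro hd
  exact h (eq_of_monic_of_associated hP.1 hQ.1 (hP.2.associated_of_dvd hQ.2 hd))

lemma MI.deg_pos {P : F[X]} (hP : MI P) : 0 < P.natDegree := hP.2.natDegree_pos

lemma MI.coprime {P Q : F[X]} (hP : MI P) (hQ : MI Q) (h : P ≠ Q) : IsCoprime P Q :=
  (hP.2.coprime_iff_not_dvd).2 (hP.not_dvd hQ h)

/-- sum of reciprocal norms -/
noncomputable def Lsum (S : Finset F[X]) : ℝ := ∑ P ∈ S, ((Fintype.card F : ℝ) ^ P.natDegree)⁻¹

lemma q_two : (2:ℝ) ≤ Fintype.card F := by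
  exact_mod_cast (Fintype.one_lt_card (α := F))

lemma card_mult_real {N : ℕ} {D : F[X]} (hD : D.Monic) (h : D.natDegree ≤ N) :
    (((G F N).filter (fun g => D ∣ g)).card : ℝ)
      = (Fintype.card F : ℝ) ^ N * ((Fintype.card F : ℝ) ^ D.natDegree)⁻¹ := by
  have hq : (0:ℝ) < Fintype.card F := by linarith [q_two (F := F)]
  rw [card_mult hD h]
  push_cast
  rw [eq_mul_inv_iff_mul_eq₀ (by positivity), ← pow_add, Nat.sub_add_cancel h]

lemma turan (S : Finset F[X]) (hS : ∀ P ∈ S, MI P) (N : ℕ) (hN : ∀ P ∈ S, 2 * P.natDegree ≤ N)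
    (K : ℕ) (hK : (K : ℝ) ≤ Lsum S) :
    (((G F N).filter (fun g => (S.filter (fun P => P ∣ g)).card < K)).card : ℝ)
      * (Lsum S - K)^2 ≤ Lsum S * (Fintype.card F : ℝ)^N := by
  set q : ℝ := (Fintype.card F : ℝ) with hqdef
  have hq : 0 < q := by linarith [q_two (F := F)]
  set L := Lsum S with hL
  let w : F[X] → ℝ := fun g => ∑ P ∈ S, if P ∣ g then 1 else 0
  have hw : ∀ g, w g = ((S.filter (fun P => P ∣ g)).card : ℝ) := by
    intro g; simp [w]
  have s1 : ∑ g ∈ G F N, w g = q^N * L := by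
    simp only [w]
    rw [Finset.sum_comm, hL, Lsum, Finset.mul_sum]
    refine Finset.sum_congr rfl fun P hP => ?_
    rw [← card_mult_real (hS P hP).1 (by have := hN P hP; omega)]
    simp
  have s2 : ∑ g ∈ G F N, (w g)^2 ≤ q^N * (L + L^2) := by
    have e1 : ∀ g, (w g)^2 = ∑ P ∈ S, ∑ Q ∈ S, (if P ∣ g ∧ Q ∣ g then (1:ℝ) else 0) := by
      intro g
      simp only [w]
      rw [pow_two, Finset.sum_mul_sum]
      refine Finset.sum_congr rfl fun P _ => Finset.sum_congr rfl fun Q _ => ?_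
      by_cases h1 : P ∣ g <;> by_cases h2 : Q ∣ g <;> simp [h1, h2]
    simp only [e1]
    rw [Finset.sum_comm]
    have e2 : q^N * (L + L^2) = ∑ P ∈ S, (q^N * (q^P.natDegree)⁻¹ +
        ∑ Q ∈ S, q^N * ((q^P.natDegree)⁻¹ * (q^Q.natDegree)⁻¹)) := by
      rw [Finset.sum_add_distrib, mul_add, pow_two L, hL, Lsum, Finset.sum_mul_sum, Finset.mul_sum,
        Finset.mul_sum]
      simp only [Finset.mul_sum, hqdef]
    rw [e2]
    refine Finset.sum_le_sum fun P hP => ?_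
    rw [Finset.sum_comm]
    have e3 : q^N * (q^P.natDegree)⁻¹ = ∑ Q ∈ S, if Q = P then q^N * (q^P.natDegree)⁻¹ else 0 := by
      simp [hP]
    rw [e3, ← Finset.sum_add_distrib]
    refine Finset.sum_le_sum fun Q hQ => ?_
    by_cases hQP : Q = P
    · subst hQP
      rw [if_pos rfl, ← card_mult_real (hS Q hQ).1 (by have := hN Q hQ; omega)]
      have : (0:ℝ) ≤ q^N * ((q^Q.natDegree)⁻¹ * (q^Q.natDegree)⁻¹) := by positivity
      simpa using this
    · rw [if_neg hQP, zero_add]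
      have hc := (hS P hP).coprime (hS Q hQ) (Ne.symm hQP)
      have hmul : (P * Q).natDegree = P.natDegree + Q.natDegree :=
        (hS P hP).1.natDegree_mul (hS Q hQ).1
      have e4 := card_mult_real (F := F) (N := N) (D := P * Q) ((hS P hP).1.mul (hS Q hQ).1)
        (by rw [hmul]; have := hN P hP; have := hN Q hQ; omega)
      rw [hmul, pow_add, mul_inv] at e4
      rw [← e4]
      rw [Finset.sum_boole]
      gcongr
      rename_i x
      rintro ⟨h1, h2⟩
      exact hc.mul_dvd h1 h2
  have hcardG : (((G F N).card : ℕ) : ℝ) = q^N := by rw [card_G]; push_cast; rfl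
  have s3 : ∑ g ∈ G F N, (w g - L)^2 ≤ L * q^N := by
    have : ∑ g ∈ G F N, (w g - L)^2 = ∑ g ∈ G F N, (w g)^2 - 2 * L * ∑ g ∈ G F N, w g
        + q^N * L^2 := by
      rw [← hcardG, Finset.mul_sum, ← nsmul_eq_mul, ← Finset.sum_const, ← Finset.sum_sub_distrib,
        ← Finset.sum_add_distrib]
      refine Finset.sum_congr rfl fun g _ => ?_
      ring
    rw [this, s1]
    nlinarith
  refine le_trans ?_ s3
  rw [← nsmul_eq_mul, ← Finset.sum_const]
  refine le_trans (Finset.sum_le_sum ?_) (Finset.sum_le_sum_of_subset_of_nonneg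
    (Finset.filter_subset _ _) (fun g _ _ => sq_nonneg _))
  intro g hg
  have h1 := (Finset.mem_filter.1 hg).2
  have h2 : w g ≤ K := by rw [hw]; exact_mod_cast h1.le
  nlinarith

lemma fact_lemma (f : F[X]) (hf : f ≠ 0) (S : Finset F[X]) (hS : ∀ Q, MI Q → Q ∣ f → Q ∈ S) :
    ∃ a : F[X] → ℕ, f = C f.leadingCoeff * ∏ Q ∈ S, Q ^ a Q ∧ ∀ Q, MI Q → Q ∣ f → 0 < a Q := by
  refine ⟨fun Q => (UniqueFactorizationMonoid.normalizedFactors f).count Q, ?_, ?_⟩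
  · have h1 : (UniqueFactorizationMonoid.normalizedFactors f).prod =
      (UniqueFactorizationMonoid.normalizedFactors f).prod := rfl
    have hmem : ∀ Q ∈ UniqueFactorizationMonoid.normalizedFactors f, MI Q := by
      intro Q hQ
      have hi := UniqueFactorizationMonoid.irreducible_of_normalized_factor Q hQ
      refine ⟨?_, hi⟩
      have := UniqueFactorizationMonoid.normalize_normalized_factor Q hQ
      rw [← this]
      exact monic_normalize hi.ne_zero
    conv_lhs at h1 => rw [Finset.prod_multiset_count_of_subset _ S (by
      intro Q hQ
      rw [Multiset.mem_toFinset] at hQ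
      exact hS Q (hmem Q hQ) (UniqueFactorizationMonoid.dvd_of_mem_normalizedFactors hQ))]
    rw [h1]
    exact (leadingCoeff_mul_prod_normalizedFactors f).symm
  · intro Q hQ hd
    rw [Multiset.count_pos]
    obtain ⟨q, hq, hass⟩ :=
      UniqueFactorizationMonoid.exists_mem_normalizedFactors_of_dvd hf hQ.2 hd
    have : normalize q = q := UniqueFactorizationMonoid.normalize_normalized_factor q hq
    have h2 : normalize Q = Q := hQ.1.normalize_eq_self
    rw [← h2, normalize_eq_normalize_iff_associated.2 hass, this]
    exact hq

lemma Lsum_unbounded (B : ℝ) : ∃ S : Finset F[X], (∀ P ∈ S, MI P) ∧ B ≤ Lsum S := by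
  by_contra hcon
  push Not at hcon
  set q : ℝ := (Fintype.card F : ℝ) with hqdef
  have hq2 : 2 ≤ q := q_two (F := F)
  have hq : 0 < q := by linarith
  let φ : {P : F[X] // MI P} → ℝ := fun P => (q ^ P.1.natDegree)⁻¹
  have hsum : Summable φ := by
    apply summable_of_sum_le (c := B)
    · intro P; simp only [φ, Pi.zero_apply]; positivity
    · intro u
      have := hcon (u.map (Function.Embedding.subtype _)) (by
        intro P hP
        simp only [Finset.mem_map] at hP
        obtain ⟨a, _, rfl⟩ := hP
        exact a.2)
      rw [Lsum, Finset.sum_map] at this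
      exact this.le
  obtain ⟨S0, hS0⟩ := hsum.vanishing (Iio_mem_nhds (show (0:ℝ) < 1/2 by norm_num))
  set S : Finset F[X] := S0.map (Function.Embedding.subtype _) with hSdef
  have hSMI : ∀ P ∈ S, MI P := by
    intro P hP
    simp only [hSdef, Finset.mem_map] at hP
    obtain ⟨a, _, rfl⟩ := hP
    exact a.2
  have bound : ∀ N : ℕ, q^N ≤ 1 + q^N * (1/2) + q * (N:ℝ)^S.card := by
    intro N
    let t : Finset F[X] := (G F N).filter (fun P => MI P ∧ P ∉ S)
    have ht : ∀ P ∈ t, MI P := fun P hP => (Finset.mem_filter.1 hP).2.1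
    have htsum : ∑ P ∈ t, (q ^ P.natDegree)⁻¹ < 1/2 := by
      have := hS0 (t.subtype MI) (by
        rw [Finset.disjoint_left]
        intro a ha ha'
        have h1 : a.1 ∈ t := by simpa using ha
        exact (Finset.mem_filter.1 h1).2.2 (Finset.mem_map.2 ⟨a, ha', rfl⟩))
      have e : ∑ P ∈ t.subtype MI, φ P = ∑ P ∈ t, (q ^ P.natDegree)⁻¹ :=
        Finset.sum_subtype_of_mem (fun P : F[X] => (q ^ P.natDegree)⁻¹) ht
      rw [e] at this
      exact this
    let sm : Finset F[X] := Finset.univ.image (fun x : F × (S → Fin N) =>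
      C x.1 * ∏ P : S, (P : F[X]) ^ (x.2 P : ℕ))
    have hcov : G F N ⊆ ({0} ∪ t.biUnion (fun P => (G F N).filter (fun g => P ∣ g))) ∪ sm := by
      intro g hg
      by_cases h0 : g = 0
      · simp [h0]
      by_cases h1 : ∃ P, MI P ∧ P ∣ g ∧ P ∉ S
      · obtain ⟨P, hP, hd, hPS⟩ := h1
        apply Finset.mem_union_left
        apply Finset.mem_union_right
        refine Finset.mem_biUnion.2 ⟨P, Finset.mem_filter.2 ⟨?_, hP, hPS⟩,
          Finset.mem_filter.2 ⟨hg, hd⟩⟩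
        rw [mem_G] at hg ⊢
        exact lt_of_le_of_lt (degree_le_of_dvd hd h0) hg
      · push Not at h1
        apply Finset.mem_union_right
        obtain ⟨a, ha, -⟩ := fact_lemma g h0 S h1
        have hlt : ∀ P ∈ S, a P < N := by
          intro P hP
          have hd : P ^ a P ∣ g := by
            rw [ha]
            exact Dvd.dvd.mul_left (Finset.dvd_prod_of_mem _ hP) _
          have h2 := natDegree_le_of_dvd hd h0
          rw [natDegree_pow] at h2
          have h3 := (hSMI P hP).deg_pos
          rw [mem_G, degree_eq_natDegree h0, Nat.cast_lt] at hg
          nlinarith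
        refine Finset.mem_image.2 ⟨(g.leadingCoeff, fun P => ⟨a P, hlt P P.2⟩),
          Finset.mem_univ _, ?_⟩
        conv_rhs => rw [ha]
        simp only
        rw [Finset.prod_coe_sort S (fun P => P ^ a P)]
    have hc := Finset.card_le_card hcov
    have hsm : sm.card ≤ Fintype.card F * N ^ S.card := by
      refine Finset.card_image_le.trans ?_
      simp
    have hb : ((t.biUnion (fun P => (G F N).filter (fun g => P ∣ g))).card : ℝ)
        ≤ q^N * (1/2) := by
      calc ((t.biUnion (fun P => (G F N).filter (fun g => P ∣ g))).card : ℝ)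
          ≤ ∑ P ∈ t, (((G F N).filter (fun g => P ∣ g)).card : ℝ) := by
            exact_mod_cast Finset.card_biUnion_le
        _ = ∑ P ∈ t, q^N * (q^P.natDegree)⁻¹ := by
            refine Finset.sum_congr rfl fun P hP => ?_
            refine card_mult_real (ht P hP).1 ?_
            have := (mem_G.1 (Finset.mem_filter.1 hP).1)
            rw [degree_eq_natDegree (ht P hP).1.ne_zero, Nat.cast_lt] at this
            exact this.le
        _ = q^N * ∑ P ∈ t, (q^P.natDegree)⁻¹ := by rw [Finset.mul_sum]
        _ ≤ _ := by gcongr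
    rw [card_G] at hc
    have hc2 := hc.trans (Finset.card_union_le _ _)
    have hc3 := hc2.trans (Nat.add_le_add_right (Finset.card_union_le _ _) _)
    rw [Finset.card_singleton] at hc3
    have hc4 : q^N ≤ 1 + ((t.biUnion (fun P => (G F N).filter (fun g => P ∣ g))).card : ℝ)
        + (sm.card : ℝ) := by rw [hqdef]; exact_mod_cast hc3
    have hsm' : (sm.card : ℝ) ≤ q * (N:ℝ)^S.card := by rw [hqdef]; exact_mod_cast hsm
    linarith
  have t1 := (tendsto_pow_const_div_const_pow_of_one_lt S.card (show 1 < q by linarith)).const_mul q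
  have t2 := (tendsto_pow_const_div_const_pow_of_one_lt 0 (show 1 < q by linarith))
  have t3 := t2.add t1
  simp only [mul_zero, add_zero, pow_zero] at t3
  obtain ⟨N, hN⟩ := (t3.eventually (Iio_mem_nhds (show (0:ℝ) < 1/2 by norm_num))).exists
  have hb := bound N
  have hp : 0 < q^N := by positivity
  replace hN : 1 / q^N + q * ((N:ℝ)^S.card / q^N) < 1/2 := hN
  have h5 : 1 / q^N + q * ((N:ℝ)^S.card / q^N) = (1 + q * (N:ℝ)^S.card) / q^N := by ring
  rw [h5, div_lt_iff₀ hp] at hN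
  linarith

/-- few prime factors is rare -/
lemma few_primes (K : ℕ) (η : ℝ) (hη : 0 < η) : ∃ N0, ∀ N ≥ N0,
    (((G F N).filter (fun g => ∃ s : Finset F[X], (∀ P ∈ s, MI P) ∧ s.card < K ∧
      g = ∏ P ∈ s, P)).card : ℝ) ≤ η * (Fintype.card F : ℝ)^N := by
  obtain ⟨S, hS, hL⟩ := Lsum_unbounded (F := F) (2 * K + 4 / η + 1)
  set L := Lsum S
  have h4 : 0 < 4 / η := by positivity
  have hKL : (K:ℝ) ≤ L := by have : (0:ℝ) ≤ K := by positivity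
                             linarith
  refine ⟨∑ P ∈ S, 2 * P.natDegree, fun N hN => ?_⟩
  have ht := turan S hS N (fun P hP => le_trans
    (Finset.single_le_sum (f := fun P : F[X] => 2 * P.natDegree) (fun _ _ => Nat.zero_le _) hP) hN)
    K hKL
  have hsub : ((G F N).filter (fun g => ∃ s : Finset F[X], (∀ P ∈ s, MI P) ∧ s.card < K ∧
      g = ∏ P ∈ s, P)) ⊆ (G F N).filter (fun g => (S.filter (fun P => P ∣ g)).card < K) := by
    intro g hg
    rw [Finset.mem_filter] at hg ⊢
    obtain ⟨hg, s, hs, hsK, rfl⟩ := hg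
    refine ⟨hg, lt_of_le_of_lt (Finset.card_le_card ?_) hsK⟩
    intro P hP
    rw [Finset.mem_filter] at hP
    have hPMI := hS P hP.1
    obtain ⟨Q, hQ, hd⟩ := (Prime.dvd_finsetProd_iff hPMI.2.prime _).1 hP.2
    by_contra hne
    exact hPMI.not_dvd (hs Q hQ) (fun h => hne (h ▸ hQ)) hd
  have hc : (((G F N).filter (fun g => ∃ s : Finset F[X], (∀ P ∈ s, MI P) ∧ s.card < K ∧
      g = ∏ P ∈ s, P)).card : ℝ) ≤
      (((G F N).filter (fun g => (S.filter (fun P => P ∣ g)).card < K)).card : ℝ) := by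
    exact_mod_cast Finset.card_le_card hsub
  refine hc.trans ?_
  set A := (((G F N).filter (fun g => (S.filter (fun P => P ∣ g)).card < K)).card : ℝ)
  have hA : 0 ≤ A := by positivity
  have hqN : 0 ≤ (Fintype.card F : ℝ)^N := by positivity
  have hLpos : 0 < L := by have : (0:ℝ) ≤ K := by positivity
                           linarith
  have h1 : L / 2 ≤ L - K := by linarith
  have h2 : (L/2)^2 ≤ (L-K)^2 := by gcongr
  have h3 : A * (L/2)^2 ≤ L * (Fintype.card F : ℝ)^N := le_trans (by gcongr) ht
  have h5 : A * L ≤ 4 * (Fintype.card F : ℝ)^N := by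
    have : L * (A * L) ≤ L * (4 * (Fintype.card F : ℝ)^N) := by nlinarith
    exact le_of_mul_le_mul_left this hLpos
  have h6 : A * (4/η) ≤ 4 * (Fintype.card F : ℝ)^N := le_trans (by
    gcongr; have : (0:ℝ) ≤ K := by positivity
    linarith) h5
  have h7 : A * (4/η) = 4 * (A / η) := by ring
  rw [h7] at h6
  have h8 : A / η ≤ (Fintype.card F : ℝ)^N := by linarith
  rw [div_le_iff₀ hη] at h8
  linarith

/-- monic polynomials of degree `d` -/
noncomputable def Mon (F : Type*) [Field F] [Fintype F] (d : ℕ) : Finset F[X] :=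
  (G F d).image (fun p => X ^ d + p)

lemma mem_Mon {d : ℕ} {p : F[X]} : p ∈ Mon F d ↔ p.Monic ∧ p.natDegree = d := by
  simp only [Mon, Finset.mem_image, mem_G]
  constructor
  · rintro ⟨r, hr, rfl⟩
    refine ⟨monic_X_pow_add hr, ?_⟩
    rw [natDegree_add_eq_left_of_degree_lt (by rwa [degree_X_pow])]
    simp
  · rintro ⟨hm, rfl⟩
    refine ⟨p - X ^ p.natDegree, ?_, by ring⟩
    have h := degree_sub_lt_left (p := p) (q := X ^ p.natDegree)
      (by rw [degree_X_pow, degree_eq_natDegree hm.ne_zero]) hm.ne_zero (by simp [hm.leadingCoeff])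
    rwa [degree_eq_natDegree hm.ne_zero] at h

lemma card_Mon (d : ℕ) : (Mon F d).card = Fintype.card F ^ d := by
  rw [Mon, Finset.card_image_of_injective _ (add_right_injective _), card_G]

lemma geom_bound (d : ℕ) : ∑ j ∈ Finset.Icc 1 d, ((1:ℝ)/4)^j ≤ 1/2 := by
  have : ∀ d : ℕ, ∑ j ∈ Finset.Icc 1 d, ((1:ℝ)/4)^j = (1 - (1/4)^d)/3 := by
    intro d
    induction d with
    | zero => simp
    | succ d ih => rw [Finset.sum_Icc_succ_top (by omega), ih]; ring
  rw [this]
  have : (0:ℝ) ≤ (1/4)^d := by positivity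
  linarith

lemma nfree_lower (n : ℕ) (hn : 3 ≤ n) (d : ℕ) : (Fintype.card F : ℝ)^d ≤
    2 * (((Mon F d).filter (fun f => ∀ Q : F[X], 0 < Q.natDegree → ¬ Q ^ n ∣ f)).card : ℝ) := by
  set q : ℝ := (Fintype.card F : ℝ) with hqdef
  have hq2 : 2 ≤ q := q_two (F := F)
  have hq : 0 < q := by linarith
  let J := (Finset.Icc 1 d).filter (fun j => n * j ≤ d)
  let bad : Finset F[X] := J.biUnion (fun j =>
    (Mon F j ×ˢ Mon F (d - n * j)).image (fun x => x.1 ^ n * x.2))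
  have hcov : Mon F d ⊆
      ((Mon F d).filter (fun f => ∀ Q : F[X], 0 < Q.natDegree → ¬ Q ^ n ∣ f)) ∪ bad := by
    intro f hf
    by_cases h : ∀ Q : F[X], 0 < Q.natDegree → ¬ Q ^ n ∣ f
    · exact Finset.mem_union_left _ (Finset.mem_filter.2 ⟨hf, h⟩)
    · push Not at h
      apply Finset.mem_union_right
      obtain ⟨Q, hQ, hd⟩ := h
      have hQu : ¬ IsUnit Q := fun hu => by
        rw [natDegree_eq_zero_of_isUnit hu] at hQ; omega
      obtain ⟨P, hPm, hPi, hPQ⟩ := exists_monic_irreducible_factor Q hQu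
      obtain ⟨k, hk⟩ := (pow_dvd_pow_of_dvd hPQ n).trans hd
      rw [mem_Mon] at hf
      have hkm : k.Monic := (hPm.pow n).of_mul_monic_left (hk ▸ hf.1)
      have hdeg : n * P.natDegree + k.natDegree = d := by
        rw [← hf.2, hk, (hPm.pow n).natDegree_mul hkm, hPm.natDegree_pow]
      have hPpos := hPi.natDegree_pos
      refine Finset.mem_biUnion.2 ⟨P.natDegree, ?_, Finset.mem_image.2 ⟨(P, k), ?_, hk.symm⟩⟩
      · simp only [J, Finset.mem_filter, Finset.mem_Icc]
        refine ⟨⟨hPpos, ?_⟩, by omega⟩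
        nlinarith
      · simp only [Finset.mem_product, mem_Mon]
        exact ⟨⟨hPm, trivial⟩, hkm, by omega⟩
  have hbad : (bad.card : ℝ) ≤ q^d * (1/2) := by
    calc (bad.card : ℝ) ≤ ∑ j ∈ J, (((Mon F j ×ˢ Mon F (d - n * j)).image
            (fun x => x.1 ^ n * x.2)).card : ℝ) := by exact_mod_cast Finset.card_biUnion_le
      _ ≤ ∑ j ∈ J, q^d * (1/4)^j := by
          refine Finset.sum_le_sum fun j hj => ?_
          have hj' := (Finset.mem_filter.1 hj).2
          have h1 : (((Mon F j ×ˢ Mon F (d - n * j)).image (fun x => x.1 ^ n * x.2)).card : ℝ)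
              ≤ q ^ (j + (d - n * j)) := by
            have := Finset.card_image_le (s := Mon F j ×ˢ Mon F (d - n * j))
              (f := fun x => x.1 ^ n * x.2)
            rw [Finset.card_product, card_Mon, card_Mon, ← pow_add] at this
            rw [hqdef]; exact_mod_cast this
          refine h1.trans ?_
          have h3 : 3 * j ≤ n * j := Nat.mul_le_mul_right j hn
          have h2 : q ^ (j + (d - n*j)) ≤ q ^ (d - 2*j) := by
            apply pow_le_pow_right₀ (by linarith); omega
          refine h2.trans ?_
          have h4 : q^d = q^(d-2*j) * (q^2)^j := by
            rw [← pow_mul, ← pow_add]; congr 1; omega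
          rw [h4, mul_assoc, ← mul_pow]
          have h5 : (1:ℝ) ≤ (q^2 * (1/4))^j := by
            apply one_le_pow₀; nlinarith
          have h6 : 0 < q^(d-2*j) := by positivity
          nlinarith
      _ ≤ ∑ j ∈ Finset.Icc 1 d, q^d * (1/4)^j :=
          Finset.sum_le_sum_of_subset_of_nonneg (Finset.filter_subset _ _)
            (fun _ _ _ => by positivity)
      _ = q^d * ∑ j ∈ Finset.Icc 1 d, (1/4)^j := by rw [Finset.mul_sum]
      _ ≤ _ := by
          have := geom_bound d
          gcongr
  have hc := (Finset.card_le_card hcov).trans (Finset.card_union_le _ _)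
  rw [card_Mon] at hc
  have hc' : q^d ≤ (((Mon F d).filter
      (fun f => ∀ Q : F[X], 0 < Q.natDegree → ¬ Q ^ n ∣ f)).card : ℝ) + (bad.card : ℝ) := by
    rw [hqdef]; exact_mod_cast hc
  linarith

end Polys

section Main

variable {F : Type*} [Field F] [Fintype F]

noncomputable def EE (f : F[X]) (i : ℕ) : ℕ :=
  ∑ᶠ Q ∈ {Q : F[X] | Q.Monic ∧ Irreducible Q ∧ Q ^ i ∣ f ∧ ¬ Q ^ (i + 1) ∣ f}, Q.natDegree

noncomputable def mm (n : ℕ) (f : F[X]) : ℕ :=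
  (∑ i ∈ Finset.Icc 1 (n - 1), EE f i) + if n ∣ f.natDegree then 0 else 1

def ordi (n : ℕ) (f : F[X]) : Prop :=
  ((n ∣ f.natDegree ∧ ∀ i, 1 ≤ i → i ≤ n - 1 → EE f i = EE f (n - i)) ∨
       (¬ n ∣ f.natDegree ∧ ∀ i₀, 1 ≤ i₀ → i₀ ≤ n - 1 → (f.natDegree + i₀) % n = 0 →
          (EE f i₀ + 1 = EE f (n - i₀) ∧
            ∀ j, 1 ≤ j → j ≤ n - 1 → j ≠ i₀ → j ≠ n - i₀ → EE f j = EE f (n - j))))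

def nfree (n : ℕ) (f : F[X]) : Prop := ∀ Q : F[X], 0 < Q.natDegree → ¬ Q ^ n ∣ f

noncomputable def build {n : ℕ} (s : Finset F[X]) (c : s → (ZMod n)ˣ) : F[X] :=
  ∏ P : s, P.1 ^ ((c P : ZMod n).val)

noncomputable def xt {n : ℕ} (s : Finset F[X]) (c : s → (ZMod n)ˣ) (Q : F[X]) : ℕ :=
  if h : Q ∈ s then (c ⟨Q, h⟩ : ZMod n).val else 0

lemma xt_coe {n : ℕ} (s : Finset F[X]) (c : s → (ZMod n)ˣ) (P : s) :
    xt s c P.1 = (c P : ZMod n).val := by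
  unfold xt; rw [dif_pos P.2]

lemma build_eq {n : ℕ} (s : Finset F[X]) (c : s → (ZMod n)ˣ) :
    build s c = ∏ Q ∈ s, Q ^ xt s c Q := by
  unfold build
  rw [← Finset.prod_coe_sort s (fun Q => Q ^ xt s c Q)]
  exact Finset.prod_congr rfl fun P _ => by rw [xt_coe]

lemma pow_dvd_prod (s : Finset F[X]) (hs : ∀ P ∈ s, MI P) (a : F[X] → ℕ) (Q : F[X]) (hQ : MI Q)
    (i : ℕ) : Q ^ i ∣ ∏ P ∈ s, P ^ a P ↔ i ≤ if Q ∈ s then a Q else 0 := by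
  have nd : ∀ t : Finset F[X], t ⊆ s → Q ∉ t → ¬ Q ∣ ∏ P ∈ t, P ^ a P := by
    intro t ht hQt hd
    obtain ⟨P, hP, hd⟩ := (Prime.dvd_finsetProd_iff hQ.2.prime _).1 hd
    exact hQ.not_dvd (hs P (ht hP)) (fun h => hQt (h ▸ hP)) (hQ.2.prime.dvd_of_dvd_pow hd)
  by_cases h : Q ∈ s
  · rw [if_pos h, ← Finset.mul_prod_erase _ _ h]
    constructor
    · intro hd
      by_contra hlt
      push Not at hlt
      have h1 : Q ^ a Q * Q ∣ Q ^ a Q * ∏ P ∈ s.erase Q, P ^ a P := by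
        rw [← pow_succ]; exact (pow_dvd_pow Q hlt).trans hd
      have h2 := (mul_dvd_mul_iff_left (pow_ne_zero _ hQ.1.ne_zero)).1 h1
      exact nd _ (Finset.erase_subset _ _) (Finset.notMem_erase _ _) h2
    · intro hle
      exact (pow_dvd_pow Q hle).mul_right _
  · rw [if_neg h]
    constructor
    · intro hd
      by_contra hlt
      exact nd s (Finset.Subset.refl _) h ((dvd_pow_self Q (by omega)).trans hd)
    · intro hle
      have : i = 0 := by omega
      simp [this]

lemma pow_dvd_build {n : ℕ} (s : Finset F[X]) (hs : ∀ P ∈ s, MI P) (c : s → (ZMod n)ˣ)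
    (Q : F[X]) (hQ : MI Q) (i : ℕ) : Q ^ i ∣ build s c ↔ i ≤ xt s c Q := by
  rw [build_eq, pow_dvd_prod s hs _ Q hQ]
  by_cases h : Q ∈ s
  · rw [if_pos h]
  · rw [if_neg h]; unfold xt; rw [dif_neg h]

lemma val_pos (n : ℕ) [hn : Fact n.Prime] (u : (ZMod n)ˣ) : 0 < (u : ZMod n).val :=
  Nat.pos_of_ne_zero (by rw [Ne, ZMod.val_eq_zero]; exact u.ne_zero)

lemma xt_lt {n : ℕ} [hn : Fact n.Prime] (s : Finset F[X]) (c : s → (ZMod n)ˣ) (Q : F[X]) :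
    xt s c Q < n := by
  unfold xt; split_ifs
  · exact ZMod.val_lt _
  · exact hn.out.pos

lemma xt_pos {n : ℕ} [hn : Fact n.Prime] (s : Finset F[X]) (c : s → (ZMod n)ˣ) (Q : F[X]) :
    0 < xt s c Q ↔ Q ∈ s := by
  unfold xt; split_ifs with h
  · simp [h, val_pos]
  · simp [h]

lemma build_monic {n : ℕ} (s : Finset F[X]) (hs : ∀ P ∈ s, MI P) (c : s → (ZMod n)ˣ) :
    (build s c).Monic := by
  rw [build_eq]
  exact monic_prod_of_monic _ _ fun P hP => (hs P hP).1.pow _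

lemma build_deg {n : ℕ} (s : Finset F[X]) (hs : ∀ P ∈ s, MI P) (c : s → (ZMod n)ˣ) :
    (build s c).natDegree = ∑ P : s, (c P : ZMod n).val * P.1.natDegree := by
  unfold build
  rw [natDegree_prod_of_monic _ _ fun P _ => (hs P.1 P.2).1.pow _]
  exact Finset.sum_congr rfl fun P _ => (hs P.1 P.2).1.natDegree_pow _

lemma build_nfree {n : ℕ} [hn : Fact n.Prime] (s : Finset F[X]) (hs : ∀ P ∈ s, MI P)
    (c : s → (ZMod n)ˣ) : nfree n (build s c) := by
  intro Q hQ hd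
  have hQu : ¬ IsUnit Q := fun hu => by
    rw [natDegree_eq_zero_of_isUnit hu] at hQ; omega
  obtain ⟨P, hPm, hPi, hPQ⟩ := exists_monic_irreducible_factor Q hQu
  have := (pow_dvd_build s hs c P ⟨hPm, hPi⟩ n).1 ((pow_dvd_pow_of_dvd hPQ n).trans hd)
  have := xt_lt s c P
  omega

lemma dvd_deg_iff {n : ℕ} [hn : Fact n.Prime] (s : Finset F[X]) (hs : ∀ P ∈ s, MI P)
    (c : s → (ZMod n)ˣ) : n ∣ (build s c).natDegree ↔
      ∑ P : s, (c P : ZMod n) * ((P.1.natDegree : ℕ) : ZMod n) = 0 := by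
  rw [build_deg s hs, ← ZMod.natCast_eq_zero_iff]
  push_cast
  simp

lemma EE_build {n : ℕ} (s : Finset F[X]) (hs : ∀ P ∈ s, MI P)
    (c : s → (ZMod n)ˣ) (i : ℕ) (hi : 1 ≤ i) :
    EE (build s c) i = ∑ P : s, if (c P : ZMod n).val = i then P.1.natDegree else 0 := by
  have hset : {Q : F[X] | Q.Monic ∧ Irreducible Q ∧ Q ^ i ∣ build s c ∧ ¬ Q ^ (i + 1) ∣ build s c}
      = ↑(s.filter (fun Q => xt s c Q = i)) := by
    ext Q
    simp only [Set.mem_ofPred_eq, Finset.coe_filter]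
    constructor
    · rintro ⟨h1, h2, h3, h4⟩
      rw [pow_dvd_build s hs c Q ⟨h1, h2⟩] at h3 h4
      refine ⟨?_, by omega⟩
      by_contra h
      unfold xt at h3
      rw [dif_neg h] at h3
      omega
    · rintro ⟨h1, h2⟩
      refine ⟨(hs Q h1).1, (hs Q h1).2, ?_, ?_⟩ <;> rw [pow_dvd_build s hs c Q (hs Q h1)] <;> omega
  unfold EE
  rw [hset, finsum_mem_coe_finset, Finset.sum_filter,
    ← Finset.sum_coe_sort s (fun Q => if xt s c Q = i then Q.natDegree else 0)]
  exact Finset.sum_congr rfl fun P _ => by rw [xt_coe]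

lemma sum_EE {n : ℕ} [hn : Fact n.Prime] (s : Finset F[X]) (hs : ∀ P ∈ s, MI P)
    (c : s → (ZMod n)ˣ) (g : ℕ → ℤ) :
    ∑ i ∈ Finset.Icc 1 (n-1), g i * (EE (build s c) i : ℤ)
      = ∑ P : s, g (c P : ZMod n).val * P.1.natDegree := by
  have h1 : ∀ i ∈ Finset.Icc 1 (n-1), g i * (EE (build s c) i : ℤ) =
      ∑ P : s, if (c P : ZMod n).val = i then g i * (P.1.natDegree : ℤ) else 0 := by
    intro i hi
    rw [EE_build s hs c i (Finset.mem_Icc.1 hi).1]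
    push_cast
    rw [Finset.mul_sum]
    exact Finset.sum_congr rfl fun P _ => by split_ifs <;> simp
  rw [Finset.sum_congr rfl h1, Finset.sum_comm]
  refine Finset.sum_congr rfl fun P _ => ?_
  rw [Finset.sum_ite_eq, if_pos]
  have := val_pos n (c P)
  have := ZMod.val_lt (c P : ZMod n)
  exact Finset.mem_Icc.2 ⟨by omega, by omega⟩

lemma mm_build {n : ℕ} [hn : Fact n.Prime] (s : Finset F[X]) (hs : ∀ P ∈ s, MI P)
    (c : s → (ZMod n)ˣ) : mm n (build s c) = (∑ P ∈ s, P.natDegree) +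
      if n ∣ (build s c).natDegree then 0 else 1 := by
  unfold mm
  congr 1
  have := sum_EE s hs c (fun _ => 1)
  simp only [one_mul] at this
  rw [← Finset.sum_coe_sort s]
  exact_mod_cast this

lemma ord_phi (n : ℕ) (hodd : Odd n) (E : ℕ → ℕ) (D : ℕ)
    (h : (n ∣ D ∧ ∀ i, 1 ≤ i → i ≤ n - 1 → E i = E (n - i)) ∨
       (¬ n ∣ D ∧ ∀ i₀, 1 ≤ i₀ → i₀ ≤ n - 1 → (D + i₀) % n = 0 →
          (E i₀ + 1 = E (n - i₀) ∧
            ∀ j, 1 ≤ j → j ≤ n - 1 → j ≠ i₀ → j ≠ n - i₀ → E j = E (n - j)))) :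
    ∑ i ∈ Finset.Icc 1 (n-1), sg n i * (E i : ℤ) = 0 ∨
    ∑ i ∈ Finset.Icc 1 (n-1), sg n i * (E i : ℤ) = 1 ∨
    ∑ i ∈ Finset.Icc 1 (n-1), sg n i * (E i : ℤ) = -1 := by
  set T := ∑ i ∈ Finset.Icc 1 (n-1), sg n i * (E i : ℤ) with hT
  have hn0 : 0 < n := hodd.pos
  have hrefl : T = ∑ i ∈ Finset.Icc 1 (n-1), sg n (n-i) * (E (n-i) : ℤ) := by
    rw [hT]
    refine Finset.sum_nbij' (fun i => n - i) (fun i => n - i) ?_ ?_ ?_ ?_ ?_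
    · intro i hi; simp only [Finset.mem_Icc] at hi ⊢; omega
    · intro i hi; simp only [Finset.mem_Icc] at hi ⊢; omega
    · intro i hi; simp only [Finset.mem_Icc] at hi ⊢; omega
    · intro i hi; simp only [Finset.mem_Icc] at hi ⊢; omega
    · intro i hi
      simp only [Finset.mem_Icc] at hi
      rw [show n - (n - i) = i by omega]
  have h2 : 2 * T = ∑ i ∈ Finset.Icc 1 (n-1), sg n i * ((E i : ℤ) - E (n-i)) := by
    rw [two_mul]
    nth_rewrite 2 [hrefl]
    rw [hT, ← Finset.sum_add_distrib]
    refine Finset.sum_congr rfl fun i hi => ?_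
    simp only [Finset.mem_Icc] at hi
    rw [sg_sub n i hodd (by omega)]
    ring
  rcases h with ⟨_, h⟩ | ⟨hD, h⟩
  · left
    rw [Finset.sum_eq_zero] at h2
    · omega
    · intro i hi
      simp only [Finset.mem_Icc] at hi
      rw [h i hi.1 hi.2]; simp
  · right
    have hm : D % n ≠ 0 := fun h => hD (Nat.dvd_of_mod_eq_zero h)
    have hlt := Nat.mod_lt D hn0
    obtain ⟨i, hi⟩ : ∃ i, i = n - D % n := ⟨_, rfl⟩
    have hmod : (D + i) % n = 0 := by
      have h3 : D + i = n * (D / n) + n := by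
        have := Nat.div_add_mod D n
        omega
      rw [h3]; simp
    obtain ⟨h4, h5⟩ := h i (by omega) (by omega) hmod
    have hne : i ≠ n - i := by
      obtain ⟨k, hk⟩ := hodd
      omega
    rw [← Finset.sum_subset (s₁ := {i, n - i})] at h2
    · rw [Finset.sum_pair hne, sg_sub n i hodd (by omega), show n - (n - i) = i by omega, ← h4] at h2
      have : sg n i = 1 ∨ sg n i = -1 := by unfold sg; split_ifs <;> simp
      push_cast at h2
      rcases this with h6 | h6 <;> rw [h6] at h2 <;> omega
    · intro j hj
      simp only [Finset.mem_insert, Finset.mem_singleton] at hj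
      simp only [Finset.mem_Icc]
      omega
    · intro j hj hj'
      simp only [Finset.mem_insert, Finset.mem_singleton, not_or] at hj'
      simp only [Finset.mem_Icc] at hj
      rw [h5 j hj.1 hj.2 hj'.1 hj'.2]; simp

lemma ordi_Phi {n : ℕ} [hn : Fact n.Prime] (hodd : Odd n) (s : Finset F[X]) (hs : ∀ P ∈ s, MI P)
    (c : s → (ZMod n)ˣ) (h : ordi n (build s c)) :
    Phi n (fun P : s => P.1.natDegree) c = 0 ∨ Phi n (fun P : s => P.1.natDegree) c = 1 ∨
      Phi n (fun P : s => P.1.natDegree) c = -1 := by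
  have := ord_phi n hodd (EE (build s c)) _ h
  rw [sum_EE s hs c (sg n)] at this
  exact this

lemma build_inj {n : ℕ} [hn : Fact n.Prime] {s s' : Finset F[X]} (hs : ∀ P ∈ s, MI P)
    (hs' : ∀ P ∈ s', MI P) {c : s → (ZMod n)ˣ} {c' : s' → (ZMod n)ˣ}
    (h : build s c = build s' c') : (⟨s, c⟩ : Σ s : Finset F[X], (s → (ZMod n)ˣ)) = ⟨s', c'⟩ := by
  have hx : ∀ Q, MI Q → xt s c Q = xt s' c' Q := by
    intro Q hQ
    apply le_antisymm
    · rw [← pow_dvd_build s' hs' c' Q hQ, ← h, pow_dvd_build s hs c Q hQ]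
    · rw [← pow_dvd_build s hs c Q hQ, h, pow_dvd_build s' hs' c' Q hQ]
  have hss : s = s' := by
    ext Q
    constructor
    · intro hQ
      rw [← xt_pos s' c', ← hx Q (hs Q hQ), xt_pos]; exact hQ
    · intro hQ
      rw [← xt_pos s c, hx Q (hs' Q hQ), xt_pos]; exact hQ
  subst hss
  congr 1
  funext P
  have := hx P.1 (hs P.1 P.2)
  rw [xt_coe, xt_coe] at this
  exact Units.ext (ZMod.val_injective n this)

lemma build_surj {n : ℕ} [hn : Fact n.Prime] (f : F[X]) (hf : f.Monic) (hfree : nfree n f) :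
    ∃ s : Finset F[X], (∀ P ∈ s, MI P) ∧ ∃ c : s → (ZMod n)ˣ, f = build s c := by
  set s : Finset F[X] := (G F (f.natDegree + 1)).filter (fun Q => MI Q ∧ Q ∣ f) with hsdef
  have hs : ∀ P ∈ s, MI P := fun P hP => (Finset.mem_filter.1 hP).2.1
  have hsd : ∀ P ∈ s, P ∣ f := fun P hP => (Finset.mem_filter.1 hP).2.2
  obtain ⟨a, ha, hpos⟩ := fact_lemma f hf.ne_zero s (by
    intro Q hQ hd
    refine Finset.mem_filter.2 ⟨?_, hQ, hd⟩
    rw [mem_G, degree_eq_natDegree hQ.1.ne_zero, Nat.cast_lt]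
    have := natDegree_le_of_dvd hd hf.ne_zero
    omega)
  rw [hf.leadingCoeff, C_1, one_mul] at ha
  have hlt : ∀ P ∈ s, a P < n := by
    intro P hP
    by_contra hge
    push Not at hge
    refine hfree P (hs P hP).deg_pos ((pow_dvd_pow P hge).trans ?_)
    rw [ha]
    exact Finset.dvd_prod_of_mem _ hP
  have hne : ∀ P : s, ((a P.1 : ℕ) : ZMod n) ≠ 0 := by
    intro P h
    rw [ZMod.natCast_eq_zero_iff] at h
    have := Nat.le_of_dvd (hpos P.1 (hs _ P.2) (hsd _ P.2)) h
    have := hlt P.1 P.2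
    omega
  refine ⟨s, hs, fun P => Units.mk0 _ (hne P), ?_⟩
  unfold build
  conv_lhs => rw [ha]
  rw [← Finset.prod_coe_sort s (fun Q => Q ^ a Q)]
  refine Finset.prod_congr rfl fun P _ => ?_
  rw [Units.val_mk0, ZMod.val_natCast_of_lt (hlt P.1 P.2)]

noncomputable def SS (F : Type*) [Field F] [Fintype F] (M : ℕ) : Finset (Finset F[X]) :=
  (G F (M+1)).powerset.filter (fun s => (∀ P ∈ s, MI P) ∧ ∑ P ∈ s, P.natDegree ≤ M)

lemma mem_SS {M : ℕ} {s : Finset F[X]} :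
    s ∈ SS F M ↔ (∀ P ∈ s, MI P) ∧ ∑ P ∈ s, P.natDegree ≤ M := by
  unfold SS
  rw [Finset.mem_filter, Finset.mem_powerset]
  refine ⟨fun h => h.2, fun h => ⟨?_, h⟩⟩
  intro P hP
  rw [mem_G, degree_eq_natDegree (h.1 P hP).1.ne_zero, Nat.cast_lt]
  have h1 : P.natDegree ≤ ∑ P ∈ s, P.natDegree :=
    Finset.single_le_sum (f := fun P : F[X] => P.natDegree) (fun _ _ => Nat.zero_le _) hP
  have := h.2
  omega

lemma cnt {n : ℕ} [hn : Fact n.Prime] (M : ℕ) (Pr : F[X] → Prop) [DecidablePred Pr]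
    (hPr : ∀ f, Pr f → mm n f ≤ M) :
    {f : F[X] | f.Monic ∧ nfree n f ∧ Pr f}.Finite ∧
    {f : F[X] | f.Monic ∧ nfree n f ∧ Pr f}.ncard =
      ∑ s ∈ SS F M, (Finset.univ.filter (fun c : s → (ZMod n)ˣ => Pr (build s c))).card := by
  have hset : {f : F[X] | f.Monic ∧ nfree n f ∧ Pr f} =
      ↑(((SS F M).sigma (fun s => Finset.univ.filter
        (fun c : s → (ZMod n)ˣ => Pr (build s c)))).image (fun x => build x.1 x.2)) := by
    ext f
    simp only [Set.mem_ofPred_eq, Finset.coe_image, Set.mem_image, Finset.mem_coe, Finset.mem_sigma,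
      Finset.mem_filter, Finset.mem_univ, true_and]
    constructor
    · rintro ⟨h1, h2, h3⟩
      obtain ⟨s, hs, c, rfl⟩ := build_surj f h1 h2
      refine ⟨⟨s, c⟩, ⟨mem_SS.2 ⟨hs, ?_⟩, h3⟩, rfl⟩
      have := hPr _ h3
      rw [mm_build s hs] at this
      change ∑ P ∈ s, P.natDegree ≤ M
      omega
    · rintro ⟨⟨s, c⟩, ⟨h1, h2⟩, rfl⟩
      have hs := (mem_SS.1 h1).1
      exact ⟨build_monic s hs c, build_nfree s hs c, h2⟩
  rw [hset]
  refine ⟨Finset.finite_toSet _, ?_⟩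
  rw [Set.ncard_coe_finset, Finset.card_image_of_injOn, Finset.card_sigma]
  rintro ⟨s, c⟩ h ⟨s', c'⟩ h' heq
  simp only [Finset.coe_sigma, Set.mem_sigma_iff, Finset.mem_coe] at h h'
  exact build_inj (mem_SS.1 h.1).1 (mem_SS.1 h'.1).1 heq

lemma fiber_bound {n : ℕ} [hn : Fact n.Prime] (hodd : Odd n) (M : ℕ) (s : Finset F[X])
    (h : s ∈ SS F M) :
    2 ^ s.card * (Finset.univ.filter (fun c : s → (ZMod n)ˣ =>
        mm n (build s c) ≤ M ∧ ordi n (build s c))).card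
      ≤ 3 * s.card.choose (s.card / 2) * ((n-1)^2 *
        (Finset.univ.filter (fun c : s → (ZMod n)ˣ => mm n (build s c) ≤ M)).card) := by
  obtain ⟨hs, hM⟩ := mem_SS.1 h
  have hn1 : 1 ≤ n - 1 := by have := hn.out.two_le; omega
  set T := Finset.univ.filter (fun c : s → (ZMod n)ˣ => mm n (build s c) ≤ M) with hT
  set O := Finset.univ.filter (fun c : s → (ZMod n)ˣ =>
        mm n (build s c) ≤ M ∧ ordi n (build s c)) with hO
  have hOT : O ⊆ T := by
    intro c hc
    simp only [hO, hT, Finset.mem_filter] at hc ⊢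
    exact ⟨hc.1, hc.2.1⟩
  have hcard : Fintype.card s = s.card := Fintype.card_coe s
  rcases O.eq_empty_or_nonempty with hOe | ⟨c0, hc0⟩
  · rw [hOe]; simp
  have hall : (n-1)^s.card ≤ (n-1)^2 * T.card := by
    by_cases hlt : ∑ P ∈ s, P.natDegree + 1 ≤ M
    · have : T = Finset.univ := by
        rw [hT]
        apply Finset.filter_true_of_mem
        intro c _
        rw [mm_build s hs]
        split_ifs <;> omega
      rw [this, Finset.card_univ]
      have h2 : Fintype.card (s → (ZMod n)ˣ) = (n-1)^s.card := by
        simp [Nat.totient_prime hn.out]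
      rw [h2]
      exact Nat.le_mul_of_pos_left _ (by positivity)
    · have hiff : ∀ c : s → (ZMod n)ˣ, mm n (build s c) ≤ M ↔
          ∑ P : s, (c P : ZMod n) * ((P.1.natDegree : ℕ) : ZMod n) = 0 := by
        intro c
        rw [← dvd_deg_iff s hs, mm_build s hs]
        split_ifs with hd
        · simp only [hd, iff_true]; omega
        · simp only [hd, iff_false]; omega
      have h3 := spread n hodd (fun P : s => P.1.natDegree) c0
        ((hiff c0).1 (Finset.mem_filter.1 hc0).2.1)
      rw [hcard] at h3
      refine h3.trans (Nat.mul_le_mul_left _ (Finset.card_le_card ?_))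
      intro c hc
      exact Finset.mem_filter.2 ⟨Finset.mem_univ _, (hiff c).2 (Finset.mem_filter.1 hc).2⟩
  have hLO := fun v => LO n hodd (fun P : s => P.1.natDegree) (fun P => (hs P.1 P.2).deg_pos) v
  set A : ℤ → Finset (s → (ZMod n)ˣ) := fun v =>
    Finset.univ.filter (fun c => Phi n (fun P : s => P.1.natDegree) c = v) with hA
  have hA' : ∀ v, 2 ^ s.card * (A v).card ≤ s.card.choose (s.card/2) * (n-1)^s.card := by
    intro v
    have h1 := hLO v
    rw [hcard] at h1
    refine le_trans (Nat.mul_le_mul_left _ (Finset.card_le_card ?_)) h1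
    intro c hc
    exact Finset.mem_filter.2 ⟨@Finset.mem_univ _ (_) _, (Finset.mem_filter.1 hc).2⟩
  have hsub : O ⊆ (A 0 ∪ A 1) ∪ A (-1) := by
    intro c hc
    have := ordi_Phi hodd s hs c (Finset.mem_filter.1 hc).2.2
    simp only [hA, Finset.mem_union, Finset.mem_filter, Finset.mem_univ, true_and]
    tauto
  have hOc : O.card ≤ (A 0).card + (A 1).card + (A (-1)).card :=
    (Finset.card_le_card hsub).trans ((Finset.card_union_le _ _).trans
      (Nat.add_le_add_right (Finset.card_union_le _ _) _))
  calc 2 ^ s.card * O.card ≤ 2^s.card * ((A 0).card + (A 1).card + (A (-1)).card) := by gcongr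
    _ = 2^s.card * (A 0).card + 2^s.card * (A 1).card + 2^s.card * (A (-1)).card := by ring
    _ ≤ 3 * (s.card.choose (s.card/2) * (n-1)^s.card) := by
        have h1 := hA' 0
        have h2 := hA' 1
        have h3 := hA' (-1)
        linarith
    _ ≤ 3 * (s.card.choose (s.card/2) * ((n-1)^2 * T.card)) := by gcongr
    _ = _ := by ring

lemma fiber_bound_real {n : ℕ} [hn : Fact n.Prime] (hodd : Odd n) (M : ℕ) (s : Finset F[X])
    (h : s ∈ SS F M) (ε : ℝ) (hε : 0 < ε) (hw : 1 / ε^2 ≤ s.card) :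
    ((Finset.univ.filter (fun c : s → (ZMod n)ˣ =>
        mm n (build s c) ≤ M ∧ ordi n (build s c))).card : ℝ)
      ≤ 3 * ε * (n:ℝ)^2 *
        ((Finset.univ.filter (fun c : s → (ZMod n)ˣ => mm n (build s c) ≤ M)).card : ℝ) := by
  have h1 := fiber_bound hodd M s h
  set T := (Finset.univ.filter (fun c : s → (ZMod n)ˣ => mm n (build s c) ≤ M)).card
  set O := (Finset.univ.filter (fun c : s → (ZMod n)ˣ =>
        mm n (build s c) ≤ M ∧ ordi n (build s c))).card
  set w := s.card
  have h2 := choose_half_sq w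
  have h2' : ((w.choose (w/2) : ℕ) : ℝ)^2 * (w+1) ≤ 4^w := by exact_mod_cast h2
  set B : ℝ := ((w.choose (w/2) : ℕ) : ℝ)
  have hB : 0 ≤ B := by positivity
  have h3 : B ≤ ε * 2^w := by
    refine (sq_le_sq₀ hB (by positivity)).1 ?_
    rw [mul_pow, ← pow_mul, mul_comm w 2, pow_mul]
    norm_num
    rw [div_le_iff₀ (by positivity)] at hw
    have : B^2 * 1 ≤ B^2 * ((w+1) * ε^2) := by
      gcongr
      nlinarith [sq_nonneg ε]
    nlinarith [sq_nonneg ε]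
  have h1' : (2:ℝ)^w * O ≤ 3 * B * (((n - 1 : ℕ) : ℝ)^2 * T) := by
    simp only [B]; exact_mod_cast h1
  have h4 : ((n - 1 : ℕ) : ℝ) ≤ n := by exact_mod_cast Nat.sub_le _ _
  have h5 : (2:ℝ)^w * O ≤ 2^w * (3 * ε * (n:ℝ)^2 * T) := by
    calc (2:ℝ)^w * O ≤ 3 * B * (((n - 1 : ℕ) : ℝ)^2 * T) := h1'
      _ ≤ 3 * (ε * 2^w) * ((n:ℝ)^2 * T) := by gcongr
      _ = _ := by ring
  exact le_of_mul_le_mul_left h5 (by positivity)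

lemma few_SS (M K : ℕ) : ((SS F M).filter (fun s => s.card < K)).card ≤
    ((G F (M+1)).filter (fun g => ∃ s : Finset F[X], (∀ P ∈ s, MI P) ∧ s.card < K ∧
      g = ∏ P ∈ s, P)).card := by
  apply Finset.card_le_card_of_injOn (fun s => ∏ P ∈ s, P)
  · intro s hs
    simp only [Finset.coe_filter, Set.mem_ofPred_eq] at hs ⊢
    obtain ⟨h1, h2⟩ := mem_SS.1 hs.1
    refine ⟨?_, s, h1, hs.2, rfl⟩
    have hm : (∏ P ∈ s, P).Monic := monic_prod_of_monic _ _ fun P hP => (h1 P hP).1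
    rw [mem_G, degree_eq_natDegree hm.ne_zero, Nat.cast_lt,
      natDegree_prod_of_monic _ _ fun P hP => (h1 P hP).1]
    omega
  · intro s hs t ht hst
    simp only [Finset.coe_filter, Set.mem_ofPred_eq] at hs ht
    have h1 := (mem_SS.1 hs.1).1
    have h2 := (mem_SS.1 ht.1).1
    have key : ∀ u : Finset F[X], (∀ P ∈ u, MI P) → ∀ Q, MI Q → (Q ∣ ∏ P ∈ u, P ↔ Q ∈ u) := by
      intro u hu Q hQ
      have := pow_dvd_prod u hu (fun _ => 1) Q hQ 1
      simp only [pow_one] at this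
      rw [this]
      split_ifs with h <;> simp [h]
    simp only at hst
    ext Q
    constructor
    · intro hQ
      rw [← key t h2 Q (h1 Q hQ), ← hst, key s h1 Q (h1 Q hQ)]; exact hQ
    · intro hQ
      rw [← key s h1 Q (h2 Q hQ), hst, key t h2 Q (h2 Q hQ)]; exact hQ

lemma tot_lower {n : ℕ} [hn : Fact n.Prime] (hodd : Odd n) (M : ℕ) :
    (Fintype.card F : ℝ)^M ≤
      2 * ({f : F[X] | f.Monic ∧ nfree n f ∧ mm n f ≤ M + 1}.ncard : ℝ) := by
  have h3 : 3 ≤ n := by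
    have := hn.out.two_le
    obtain ⟨k, hk⟩ := hodd
    omega
  refine (nfree_lower n h3 M).trans ?_
  gcongr
  rw [← Set.ncard_coe_finset]
  apply Set.ncard_le_ncard _ (cnt (M+1) (fun f => mm n f ≤ M+1) (fun f h => h)).1
  intro f hf
  simp only [Finset.coe_filter, Set.mem_ofPred_eq, mem_Mon] at hf ⊢
  obtain ⟨⟨h1, h2⟩, h4⟩ := hf
  refine ⟨h1, h4, ?_⟩
  obtain ⟨s, hs, c, rfl⟩ := build_surj f h1 h4
  rw [mm_build s hs]
  have : ∑ P ∈ s, P.natDegree ≤ (build s c).natDegree := by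
    rw [build_deg s hs, ← Finset.sum_coe_sort s]
    refine Finset.sum_le_sum fun P _ => ?_
    exact Nat.le_mul_of_pos_left _ (val_pos n (c P))
  split_ifs <;> omega

lemma main_bound {n : ℕ} [hn : Fact n.Prime] (hodd : Odd n) (δ : ℝ) (hδ : 0 < δ) :
    ∃ M0, ∀ M ≥ M0,
      ({f : F[X] | f.Monic ∧ nfree n f ∧ mm n f ≤ M ∧ ordi n f}.ncard : ℝ) ≤
        δ * ({f : F[X] | f.Monic ∧ nfree n f ∧ mm n f ≤ M}.ncard : ℝ) := by
  set q : ℝ := (Fintype.card F : ℝ) with hqdef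
  have hq2 : 2 ≤ q := q_two (F := F)
  have hn0 : (0:ℝ) < n := by exact_mod_cast hn.out.pos
  obtain ⟨ε, hε⟩ : ∃ ε, ε = δ / (6 * (n:ℝ)^2) := ⟨_, rfl⟩
  have hεpos : 0 < ε := by rw [hε]; positivity
  obtain ⟨K, hK⟩ := exists_nat_ge (1 / ε^2)
  obtain ⟨η, hη⟩ : ∃ η, η = δ / (4 * q^2 * (n:ℝ)^K) := ⟨_, rfl⟩
  have hηpos : 0 < η := by rw [hη]; positivity
  obtain ⟨N0, hN0⟩ := few_primes (F := F) K η hηpos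
  refine ⟨N0 + 1, fun M hM => ?_⟩
  obtain ⟨M', rfl⟩ : ∃ M', M = M' + 1 := ⟨M - 1, by omega⟩
  have c1 := (cnt (F := F) (n := n) (M'+1) (fun f => mm n f ≤ M'+1 ∧ ordi n f) (fun f h => h.1)).2
  have c2 := (cnt (F := F) (n := n) (M'+1) (fun f => mm n f ≤ M'+1) (fun f h => h)).2
  have lower := tot_lower (F := F) (n := n) hodd M'
  have few := hN0 (M'+1+1) (by omega)
  have few2 : (((SS F (M'+1)).filter (fun s => s.card < K)).card : ℝ) ≤ η * q^(M'+1+1) :=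
    le_trans (by exact_mod_cast few_SS (F := F) (M'+1) K) few
  set Tot : ℝ := ({f : F[X] | f.Monic ∧ nfree n f ∧ mm n f ≤ M'+1}.ncard : ℝ) with hTot
  rw [c1]
  push_cast
  rw [← Finset.sum_filter_add_sum_filter_not (SS F (M'+1)) (fun s => s.card < K)]
  have b1 : ∑ s ∈ (SS F (M'+1)).filter (fun s => s.card < K),
      ((Finset.univ.filter (fun c : s → (ZMod n)ˣ =>
        mm n (build s c) ≤ M'+1 ∧ ordi n (build s c))).card : ℝ) ≤ δ / 2 * Tot := by
    calc _ ≤ ∑ s ∈ (SS F (M'+1)).filter (fun s => s.card < K), (n:ℝ)^K := by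
          refine Finset.sum_le_sum fun s hs => ?_
          have hsK := (Finset.mem_filter.1 hs).2
          have h1 := Finset.card_filter_le (Finset.univ : Finset (s → (ZMod n)ˣ)) (fun c =>
            mm n (build s c) ≤ M'+1 ∧ ordi n (build s c))
          have h2 : (Finset.univ : Finset (s → (ZMod n)ˣ)).card = (n-1)^s.card := by
            simp [Nat.totient_prime hn.out]
          rw [h2] at h1
          have h3 : (n-1)^s.card ≤ n^K :=
            (Nat.pow_le_pow_left (Nat.sub_le _ _) _).trans
              (Nat.pow_le_pow_right hn.out.pos hsK.le)
          exact_mod_cast h1.trans h3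
      _ = (((SS F (M'+1)).filter (fun s => s.card < K)).card : ℝ) * (n:ℝ)^K := by
          rw [Finset.sum_const, nsmul_eq_mul]
      _ ≤ (η * q^(M'+1+1)) * (n:ℝ)^K := by gcongr
      _ = δ / 4 * q^M' := by
          rw [hη]; field_simp; ring
      _ ≤ δ / 4 * (2 * Tot) := by gcongr
      _ = _ := by ring
  have b2 : ∑ s ∈ (SS F (M'+1)).filter (fun s => ¬ s.card < K),
      ((Finset.univ.filter (fun c : s → (ZMod n)ˣ =>
        mm n (build s c) ≤ M'+1 ∧ ordi n (build s c))).card : ℝ) ≤ δ / 2 * Tot := by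
    have hc : 3 * ε * (n:ℝ)^2 = δ / 2 := by rw [hε]; field_simp; norm_num
    calc _ ≤ ∑ s ∈ (SS F (M'+1)).filter (fun s => ¬ s.card < K), δ / 2 *
          ((Finset.univ.filter (fun c : s → (ZMod n)ˣ => mm n (build s c) ≤ M'+1)).card : ℝ) := by
          refine Finset.sum_le_sum fun s hs => ?_
          obtain ⟨hs1, hs2⟩ := Finset.mem_filter.1 hs
          rw [← hc]
          refine fiber_bound_real hodd (M'+1) s hs1 ε hεpos (hK.trans ?_)
          exact_mod_cast not_lt.1 hs2
      _ ≤ ∑ s ∈ SS F (M'+1), δ / 2 *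
          ((Finset.univ.filter (fun c : s → (ZMod n)ˣ => mm n (build s c) ≤ M'+1)).card : ℝ) :=
          Finset.sum_le_sum_of_subset_of_nonneg (Finset.filter_subset _ _)
            (fun _ _ _ => by positivity)
      _ = δ / 2 * Tot := by
          rw [← Finset.mul_sum, hTot, c2, Nat.cast_sum]
  linarith

end Main

end OrdProof

/-- Let `n` be an odd prime and `𝔽_q` a finite field of characteristic 2 with
`gcd(q, n) = 1`. For monic `n`-th-power-free `f ∈ 𝔽_q[x]`, `e_i(f)` is the total degree
of the distinct monic irreducible factors dividing `f` to multiplicity exactly `i`;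
`m(f) = ∑_{i=1}^{n-1} e_i(f)`, plus `1` if `n ∤ deg f`; and `f` is `ordinary` according
to the combinatorial criterion of the paper. Then the proportion of ordinary `f` among
monic `n`-th-power-free `f` with `q^{m(f)} ≤ X` tends to `0` as `X → ∞`. -/
theorem stmt_18 (Fq : Type*) [Field Fq] [Fintype Fq] (hchar : ringChar Fq = 2)
    (n : ℕ) (hn : n.Prime) (hodd : Odd n) (hcop : Nat.Coprime (Fintype.card Fq) n)
    (e : Polynomial Fq → ℕ → ℕ)
    (he : ∀ (f : Fq[X]) (i : ℕ), e f i =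
      ∑ᶠ Q ∈ {Q : Fq[X] | Q.Monic ∧ Irreducible Q ∧ Q ^ i ∣ f ∧ ¬ Q ^ (i + 1) ∣ f},
        Q.natDegree)
    (m : Polynomial Fq → ℕ)
    (hm : ∀ f : Fq[X], m f =
      (∑ i ∈ Finset.Icc 1 (n - 1), e f i) + if n ∣ f.natDegree then 0 else 1)
    (ordinary : Polynomial Fq → Prop)
    (hord : ∀ f : Fq[X], ordinary f ↔
      ((n ∣ f.natDegree ∧ ∀ i, 1 ≤ i → i ≤ n - 1 → e f i = e f (n - i)) ∨
       (¬ n ∣ f.natDegree ∧ ∀ i₀, 1 ≤ i₀ → i₀ ≤ n - 1 → (f.natDegree + i₀) % n = 0 →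
          (e f i₀ + 1 = e f (n - i₀) ∧
            ∀ j, 1 ≤ j → j ≤ n - 1 → j ≠ i₀ → j ≠ n - i₀ → e f j = e f (n - j))))) :
    Tendsto (fun X : ℝ =>
        (({f : Fq[X] | f.Monic ∧ (∀ Q : Fq[X], 0 < Q.natDegree → ¬ Q ^ n ∣ f) ∧
            (Fintype.card Fq : ℝ) ^ (m f) ≤ X ∧ ordinary f}.ncard : ℝ) /
          ({f : Fq[X] | f.Monic ∧ (∀ Q : Fq[X], 0 < Q.natDegree → ¬ Q ^ n ∣ f) ∧
            (Fintype.card Fq : ℝ) ^ (m f) ≤ X}.ncard : ℝ)))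
      atTop (𝓝 0) := by
  have hnF : Fact n.Prime := ⟨hn⟩
  have e1 : e = OrdProof.EE := by funext f i; exact he f i
  subst e1
  have e2 : m = OrdProof.mm n := by funext f; exact hm f
  subst e2
  have e3 : ordinary = OrdProof.ordi n := by funext f; exact propext (hord f)
  subst e3
  have hq1 : 1 < Fintype.card Fq := Fintype.one_lt_card
  have hlog : ∀ X : ℝ, 1 ≤ X → ∀ k : ℕ, ((Fintype.card Fq : ℝ) ^ k ≤ X ↔
      k ≤ Nat.log (Fintype.card Fq) ⌊X⌋₊) := by
    intro X hX k
    have h0 : ⌊X⌋₊ ≠ 0 := by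
      have := (Nat.one_le_floor_iff X).2 hX
      omega
    rw [Nat.le_log_iff_pow_le hq1 h0, Nat.le_floor_iff (by linarith)]
    push_cast
    rfl
  rw [Metric.tendsto_atTop]
  intro δ hδ
  obtain ⟨M0, hM0⟩ := OrdProof.main_bound (F := Fq) (n := n) hodd (δ / 2) (by positivity)
  refine ⟨(Fintype.card Fq : ℝ) ^ M0, fun X hX => ?_⟩
  have hX1 : 1 ≤ X := le_trans (one_le_pow₀ (by exact_mod_cast hq1.le)) hX
  have hM : M0 ≤ Nat.log (Fintype.card Fq) ⌊X⌋₊ := (hlog X hX1 M0).1 hX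
  have hb := hM0 _ hM
  simp only [hlog X hX1]
  unfold OrdProof.nfree at hb
  rw [Real.dist_eq, sub_zero, abs_of_nonneg (by positivity)]
  refine lt_of_le_of_lt (div_le_of_le_mul₀ (by positivity) (by positivity) hb) (by linarith)
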